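/- (Proposition 2.3, leading coefficient of P_2.) Let m, n ≥ 1 be integers, 1 ≤ ρ ≤ m and 1 ≤ ξ ≤ n. Let p ∈ ℚ[r] be the polynomial with P_2(m,n,ρ,ξ,r) = p(r) for all sufficiently large r. Then (deg p)! times the leading coefficient of p equals: 1 if m = 1 or n = 1; (1/(n−1))·C(m+n−4,m−2)·C(m+n−3,n−2) if m = ρ, ξ = 1 and m, n > 1; and (((m−ρ)(n−1)+(ρ−1)(ξ−1))/((m−1)(n−1)))·C(m+n−ξ−2,m−2)·C(ρ+n−3,n−2) in all remaining cases. -/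

import Mathlib

/-- A multiset of pairs of positive integers contains a 2-chain:
two elements (at distinct positions) with both coordinates strictly increasing. -/
def Has2Chain (S : Multiset (ℕ × ℕ)) : Prop :=
  ∃ a ∈ S, ∃ b ∈ S, a.1 < b.1 ∧ a.2 < b.2

/-- A multiset of pairs contains a 3-chain:
three elements with both coordinates strictly increasing. -/
def Has3Chain (S : Multiset (ℕ × ℕ)) : Prop :=
  ∃ a ∈ S, ∃ b ∈ S, ∃ c ∈ S, a.1 < b.1 ∧ b.1 < c.1 ∧ a.2 < b.2 ∧ b.2 < c.2

/-- The index multiset of a degree-`r` monomial in the variables `z_{i,j}`,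
`1 ≤ i ≤ m`, `1 ≤ j ≤ n`, with 1-indexed entries. -/
def idxMS (m n r : ℕ) (f : Sym (Fin m × Fin n) r) : Multiset (ℕ × ℕ) :=
  Multiset.map (fun p => (p.1.1 + 1, p.2.1 + 1)) (f : Multiset (Fin m × Fin n))

/-- `P1 m n ξ r`: number of degree-`r` monomials in the `m × n` grid of variables
whose index multiset contains no 3-chain and whose part with column index `< ξ`
contains no 2-chain. -/
noncomputable def P1 (m n ξ r : ℕ) : ℕ :=
  Nat.card {f : Sym (Fin m × Fin n) r //
    ¬ Has3Chain (idxMS m n r f) ∧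
    ¬ Has2Chain ((idxMS m n r f).filter (fun p => p.2 < ξ)) }

/-- `h3 m n r`: number of degree-`r` monomials whose index multiset contains no 3-chain. -/
noncomputable def h3 (m n r : ℕ) : ℕ :=
  Nat.card {f : Sym (Fin m × Fin n) r // ¬ Has3Chain (idxMS m n r f) }

/-- `P2 m n ρ ξ r`: number of degree-`r` monomials `f` such that every `(i,j)` in the
index multiset satisfies `i ≤ ρ` or `j ≥ ξ`, the index multiset contains no 3-chain, and
neither the part with `j < ξ` nor the part with `i > ρ` contains a 2-chain. -/
noncomputable def P2 (m n ρ ξ r : ℕ) : ℕ :=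
  Nat.card {f : Sym (Fin m × Fin n) r //
    (∀ p ∈ idxMS m n r f, p.1 ≤ ρ ∨ ξ ≤ p.2) ∧
    ¬ Has3Chain (idxMS m n r f) ∧
    ¬ Has2Chain ((idxMS m n r f).filter (fun p => p.2 < ξ)) ∧
    ¬ Has2Chain ((idxMS m n r f).filter (fun p => ρ < p.1)) }

section Proof

open Polynomial

/-- Supports of the monomials counted by `P2`, in coordinates measured from the top right corner
of the grid: the cells lie in the union of an `i₁ × k₁` and an `i₂ × k₂` rectangle sharing that
corner. -/
structure IsFace (i₁ k₁ i₂ k₂ : ℕ) (F : Finset (ℕ × ℕ)) : Prop where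
  region : ∀ a ∈ F, a.1 < i₂ ∧ a.2 < k₁ ∧ (a.1 < i₁ ∨ a.2 < k₂)
  columns : ∀ a ∈ F, ∀ b ∈ F, a.1 < b.1 → b.2 < a.2 → b.2 < k₂
  rows : ∀ a ∈ F, ∀ b ∈ F, a.1 < b.1 → b.2 < a.2 → a.1 < i₁
  chain : ∀ a ∈ F, ∀ b ∈ F, ∀ c ∈ F, a.1 < b.1 → b.1 < c.1 → b.2 < a.2 → ¬ c.2 < b.2

open Classical in
/-- The finite family of all faces. -/
noncomputable def faces (i₁ k₁ i₂ k₂ : ℕ) : Finset (Finset (ℕ × ℕ)) :=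
  (Finset.range i₂ ×ˢ Finset.range k₁).powerset.filter (IsFace i₁ k₁ i₂ k₂)

theorem mem_faces {i₁ k₁ i₂ k₂ : ℕ} {F : Finset (ℕ × ℕ)} :
    F ∈ faces i₁ k₁ i₂ k₂ ↔ IsFace i₁ k₁ i₂ k₂ F := by
  classical
  simp only [faces, Finset.mem_filter, Finset.mem_powerset, and_iff_right_iff_imp]
  intro h a ha
  have := h.region a ha
  simp [this.1, this.2.1]

/-- The generating polynomial of the faces by cardinality. -/
noncomputable def facePoly (i₁ k₁ i₂ k₂ : ℕ) : ℤ[X] :=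
  ∑ F ∈ faces i₁ k₁ i₂ k₂, X ^ F.card

section Recursion

variable {i₁ k₁ i k : ℕ} {F : Finset (ℕ × ℕ)}

theorem IsFace.subset {i₂ k₂ : ℕ} {G : Finset (ℕ × ℕ)} (h : IsFace i₁ k₁ i₂ k₂ F) (hG : G ⊆ F) :
    IsFace i₁ k₁ i₂ k₂ G where
  region a ha := h.region a (hG ha)
  columns a ha b hb := h.columns a (hG ha) b (hG hb)
  rows a ha b hb := h.rows a (hG ha) b (hG hb)
  chain a ha b hb c hc := h.chain a (hG ha) b (hG hb) c (hG hc)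

theorem IsFace.insert_corner (hk : k < k₁) (h : IsFace i₁ k₁ (i + 1) (k + 1) F) :
    IsFace i₁ k₁ (i + 1) (k + 1) (insert (i, k) F) := by
  obtain ⟨h1, h2, h3, h4⟩ := h
  constructor
  · grind
  · grind
  · grind
  · simp only [Finset.mem_insert]
    rintro a (rfl | ha) b (rfl | hb) c (rfl | hc) <;> grind

theorem isFace_succ_iff (hi : i₁ ≤ i) (hF : (i, k) ∉ F) :
    IsFace i₁ k₁ (i + 1) (k + 1) F ↔ IsFace i₁ k₁ i (k + 1) F ∨ IsFace i₁ k₁ (i + 1) k F := by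
  constructor
  · intro ⟨h1, h2, h3, h4⟩
    have hne : ∀ a ∈ F, a.1 = i → a.2 ≠ k := fun a ha h h' => hF (by rwa [← h, ← h'])
    by_cases hc : ∃ c ∈ F, c.1 = i
    · obtain ⟨c, hc, rfl⟩ := hc
      have hck : c.2 < k := by grind
      refine Or.inr ⟨fun a ha => ?_, fun a ha b hb hab hba => ?_, h3, h4⟩
      · have := h3 a ha c hc
        grind
      · have := h4 a ha b hb c hc
        grind
    · exact Or.inl ⟨fun a ha => by grind, h2, h3, h4⟩
  · rintro (⟨h1, h2, h3, h4⟩ | ⟨h1, h2, h3, h4⟩)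
    · exact ⟨fun a ha => by grind, h2, h3, h4⟩
    · exact ⟨fun a ha => by grind, by grind, h3, h4⟩

theorem isFace_and_iff :
    IsFace i₁ k₁ i (k + 1) F ∧ IsFace i₁ k₁ (i + 1) k F ↔ IsFace i₁ k₁ i k F := by
  constructor
  · rintro ⟨⟨h1, h2, h3, h4⟩, ⟨h1', h2', h3', h4'⟩⟩
    exact ⟨fun a ha => by grind, h2', h3, h4⟩
  · rintro ⟨h1, h2, h3, h4⟩
    exact ⟨⟨fun a ha => by grind, by grind, h3, h4⟩, ⟨fun a ha => by grind, h2, h3, h4⟩⟩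

/-- The corner of the second rectangle is a cone point, and deleting it splits the faces. -/
theorem facePoly_succ_succ (hi : i₁ ≤ i) (hk : k < k₁) :
    facePoly i₁ k₁ (i + 1) (k + 1) =
      (1 + X) * (facePoly i₁ k₁ i (k + 1) + facePoly i₁ k₁ (i + 1) k - facePoly i₁ k₁ i k) := by
  classical
  set S := faces i₁ k₁ i (k + 1) ∪ faces i₁ k₁ (i + 1) k with hS
  have hmem : ∀ F, F ∈ S ↔ (i, k) ∉ F ∧ IsFace i₁ k₁ (i + 1) (k + 1) F := by
    intro F
    rw [hS, Finset.mem_union, mem_faces, mem_faces]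
    refine ⟨fun h => ?_, fun h => (isFace_succ_iff hi h.1).1 h.2⟩
    have hF : (i, k) ∉ F := by
      intro hF
      rcases h with h | h
      · have := h.region _ hF; simp at this
      · have := h.region _ hF; simp at this; omega
    exact ⟨hF, (isFace_succ_iff hi hF).2 h⟩
  have hsplit : faces i₁ k₁ (i + 1) (k + 1) = S ∪ S.image (insert (i, k)) := by
    ext F
    simp only [Finset.mem_union, Finset.mem_image, hmem, mem_faces]
    constructor
    · intro h
      by_cases hF : (i, k) ∈ F
      · exact Or.inr ⟨F.erase (i, k), ⟨Finset.notMem_erase _ _, h.subset (Finset.erase_subset _ _)⟩,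
          Finset.insert_erase hF⟩
      · exact Or.inl ⟨hF, h⟩
    · rintro (h | ⟨G, h, rfl⟩)
      · exact h.2
      · exact h.2.insert_corner hk
  have hdisj : Disjoint S (S.image (insert (i, k))) := by
    rw [Finset.disjoint_left]
    intro F hF hF'
    obtain ⟨G, -, rfl⟩ := Finset.mem_image.1 hF'
    exact ((hmem _).1 hF).1 (Finset.mem_insert_self _ _)
  have hinj : Set.InjOn (insert (i, k)) (S : Set (Finset (ℕ × ℕ))) := by
    intro F hF G hG h
    rw [← Finset.erase_insert ((hmem F).1 hF).1, h, Finset.erase_insert ((hmem G).1 hG).1]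
  have hinter : faces i₁ k₁ i (k + 1) ∩ faces i₁ k₁ (i + 1) k = faces i₁ k₁ i k := by
    ext F
    rw [Finset.mem_inter, mem_faces, mem_faces, mem_faces, isFace_and_iff]
  have hsum : ∑ F ∈ S, (X : ℤ[X]) ^ F.card =
      facePoly i₁ k₁ i (k + 1) + facePoly i₁ k₁ (i + 1) k - facePoly i₁ k₁ i k := by
    rw [eq_sub_iff_add_eq, facePoly, facePoly, facePoly, ← hinter]
    exact Finset.sum_union_inter
  rw [← hsum, facePoly, hsplit, Finset.sum_union hdisj, Finset.sum_image hinj, add_mul, one_mul,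
    Finset.mul_sum]
  congr 1
  refine Finset.sum_congr rfl fun F hF => ?_
  rw [Finset.card_insert_of_notMem ((hmem F).1 hF).1, pow_succ']

end Recursion

theorem facePoly_transpose (i₁ k₁ i₂ k₂ : ℕ) :
    facePoly i₁ k₁ i₂ k₂ = facePoly k₂ i₂ k₁ i₁ := by
  have key : ∀ {i₁ k₁ i₂ k₂ : ℕ} {F : Finset (ℕ × ℕ)}, IsFace i₁ k₁ i₂ k₂ F →
      IsFace k₂ i₂ k₁ i₁ (F.map (Equiv.prodComm ℕ ℕ).toEmbedding) := by
    rintro i₁ k₁ i₂ k₂ F ⟨h1, h2, h3, h4⟩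
    constructor <;> simp only [Finset.mem_map_equiv]
    · intro a ha; have := h1 _ ha; simp at this; tauto
    · intro a ha b hb h h'; exact h3 _ hb _ ha h' h
    · intro a ha b hb h h'; exact h2 _ hb _ ha h' h
    · intro a ha b hb c hc h h' h'' h'''; exact h4 _ hc _ hb _ ha h''' h'' h' h
  refine Finset.sum_bij' (fun F _ => F.map (Equiv.prodComm ℕ ℕ).toEmbedding)
    (fun F _ => F.map (Equiv.prodComm ℕ ℕ).toEmbedding)
    (fun F hF => mem_faces.2 (key (mem_faces.1 hF)))
    (fun F hF => mem_faces.2 (key (mem_faces.1 hF))) ?_ ?_ ?_ <;> intro F _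
  · ext; simp
  · ext; simp
  · simp

theorem facePoly_zero {i₁ i i' : ℕ} (k₁ : ℕ) (h : i₁ ≤ i) (h' : i₁ ≤ i') :
    facePoly i₁ k₁ i 0 = facePoly i₁ k₁ i' 0 := by
  have key : ∀ {i i' F}, i₁ ≤ i' → IsFace i₁ k₁ i 0 F → IsFace i₁ k₁ i' 0 F := by
    rintro i i' F h' ⟨h1, h2, h3, h4⟩
    exact ⟨fun a ha => by grind, h2, h3, h4⟩
  have : faces i₁ k₁ i 0 = faces i₁ k₁ i' 0 := by
    ext F
    rw [mem_faces, mem_faces]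
    exact ⟨key h', key h⟩
  rw [facePoly, facePoly, this]

theorem facePoly_one_row {k₁ k : ℕ} : facePoly 1 k₁ 1 k = (1 + X) ^ k₁ := by
  have : faces 1 k₁ 1 k = (Finset.range 1 ×ˢ Finset.range k₁).powerset := by
    ext F
    rw [mem_faces, Finset.mem_powerset]
    constructor
    · intro h a ha
      have := h.region a ha
      simp only [Finset.mem_product, Finset.mem_range]
      tauto
    · intro h
      have h' : ∀ a ∈ F, a.1 < 1 ∧ a.2 < k₁ := fun a ha => by
        simpa only [Finset.mem_product, Finset.mem_range] using h ha
      constructor <;> grind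
  rw [facePoly, this]
  have h := Finset.sum_pow_mul_eq_add_pow (X : ℤ[X]) 1 (Finset.range 1 ×ˢ Finset.range k₁)
  simpa [add_comm] using h

/-- When the starting corners coincide, one of them can be moved without changing the faces. -/
theorem faces_diagonal (m n : ℕ) : faces (m + 1) n (m + 1) n = faces m n (m + 1) n := by
  ext F
  rw [mem_faces, mem_faces]
  constructor <;> rintro ⟨h1, h2, h3, h4⟩ <;>
    exact ⟨fun a ha => by grind, h2, by grind, h4⟩

theorem facePoly_two_rows {k₁ k : ℕ} (hk : k ≤ k₁) : facePoly 1 k₁ 2 k = (1 + X) ^ (k₁ + k) := by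
  induction k with
  | zero => rw [facePoly_zero k₁ one_le_two le_rfl, facePoly_one_row, add_zero]
  | succ k ih =>
    rw [facePoly_succ_succ le_rfl hk, ih (by omega), facePoly_one_row, facePoly_one_row]
    ring

/-- The `2 × 2` determinant counting pairs of nonintersecting lattice paths from the corners of
the two rectangles. -/
def pathPairs (i₁ k₁ i₂ k₂ : ℕ) : ℤ :=
  (i₁ + k₁ - 3).choose (k₁ - 2) * (i₂ + k₂ - 3).choose (i₂ - 2) -
    (i₁ + k₁ - 3).choose (k₁ - 1) * (i₂ + k₂ - 3).choose (i₂ - 1)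

theorem pathPairs_transpose (i₁ k₁ i₂ k₂ : ℕ) :
    pathPairs i₁ k₁ i₂ k₂ = pathPairs k₂ i₂ k₁ i₁ := by
  rw [pathPairs, pathPairs, add_comm k₂, add_comm k₁]
  ring

theorem pathPairs_diagonal (m n : ℕ) : pathPairs (m + 2) (n + 2) (m + 2) (n + 2) = 0 := by
  have h₁ : (m + n + 1).choose n = (m + n + 1).choose (m + 1) :=
    Nat.choose_symm_of_eq_add (by omega)
  have h₂ : (m + n + 1).choose (n + 1) = (m + n + 1).choose m :=
    Nat.choose_symm_of_eq_add (by omega)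
  have h₃ : m + 2 + (n + 2) - 3 = m + n + 1 := by omega
  simp only [pathPairs, h₃, Nat.add_sub_cancel, show n + 2 - 1 = n + 1 by omega,
    show m + 2 - 1 = m + 1 by omega, h₁, h₂]
  ring

theorem pathPairs_succ_succ (i₁ k₁ i k : ℕ) :
    pathPairs i₁ k₁ (i + 3) (k + 2) =
      pathPairs i₁ k₁ (i + 2) (k + 2) + pathPairs i₁ k₁ (i + 3) (k + 1) := by
  have h₁ : (i + k + 2).choose (i + 1) = (i + k + 1).choose i + (i + k + 1).choose (i + 1) :=
    Nat.choose_succ_succ _ _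
  have h₂ : (i + k + 2).choose (i + 2) = (i + k + 1).choose (i + 1) + (i + k + 1).choose (i + 2) :=
    Nat.choose_succ_succ _ _
  simp only [pathPairs, show i + 3 + (k + 2) - 3 = i + k + 2 by omega,
    show i + 2 + (k + 2) - 3 = i + k + 1 by omega, show i + 3 + (k + 1) - 3 = i + k + 1 by omega,
    show i + 3 - 2 = i + 1 by omega, show i + 3 - 1 = i + 2 by omega,
    show i + 2 - 2 = i by omega, show i + 2 - 1 = i + 1 by omega, h₁, h₂]
  push_cast
  ring

theorem pathPairs_succ_one (i₁ k₁ i : ℕ) :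
    pathPairs i₁ k₁ (i + 3) 1 = pathPairs i₁ k₁ (i + 2) 1 := by
  simp [pathPairs]

theorem natDegree_one_add_X_mul_le {p : ℤ[X]} {d : ℕ} (hp : p.natDegree ≤ d) :
    ((1 + X) * p).natDegree ≤ d + 1 := by
  refine natDegree_mul_le.trans ?_
  have : (1 + X : ℤ[X]).natDegree ≤ 1 := by compute_degree
  omega

theorem coeff_one_add_X_mul {p : ℤ[X]} {d : ℕ} (hp : p.natDegree ≤ d) :
    ((1 + X) * p).coeff (d + 1) = p.coeff d := by
  rw [add_mul, one_mul, coeff_add, coeff_X_mul, coeff_eq_zero_of_natDegree_lt (by omega), zero_add]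

theorem natDegree_le_and_coeff_one_add_X_pow (d : ℕ) :
    ((1 + X : ℤ[X]) ^ d).natDegree ≤ d ∧ ((1 + X : ℤ[X]) ^ d).coeff d = 1 := by
  constructor
  · compute_degree
  · rw [coeff_one_add_X_pow, Nat.choose_self, Nat.cast_one]

theorem facePoly_natDegree_le_and_coeff {s i₁ k₁ i₂ k₂ d : ℕ} (hs : i₁ + k₁ + i₂ + k₂ = s)
    (hi₁ : 1 ≤ i₁) (hi : i₁ ≤ i₂) (hk₂ : 1 ≤ k₂) (hk : k₂ ≤ k₁) (hi₂ : 2 ≤ i₂) (hk₁ : 2 ≤ k₁)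
    (hd : i₁ + k₁ + i₂ + k₂ = d + 3) :
    (facePoly i₁ k₁ i₂ k₂).natDegree ≤ d ∧
      (facePoly i₁ k₁ i₂ k₂).coeff d = pathPairs i₁ k₁ i₂ k₂ := by
  induction s using Nat.strong_induction_on generalizing i₁ k₁ i₂ k₂ d with
  | _ s ih =>
  by_cases hdiag : i₁ = i₂ ∧ k₁ = k₂
  · obtain ⟨rfl, rfl⟩ := hdiag
    obtain ⟨m, rfl⟩ := Nat.exists_eq_add_of_le' hi₂
    obtain ⟨n, rfl⟩ := Nat.exists_eq_add_of_le' hk₁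
    obtain ⟨e, rfl⟩ : ∃ e, d = e + 1 := ⟨d - 1, by omega⟩
    rw [facePoly, faces_diagonal, ← facePoly, pathPairs_diagonal]
    obtain ⟨h, -⟩ := ih _ (by omega) rfl (i₁ := m + 1) (k₁ := n + 2) (i₂ := m + 1 + 1)
      (k₂ := n + 2) (d := e) (by omega) (by omega) (by omega) le_rfl (by omega) (by omega)
      (by omega)
    exact ⟨by omega, coeff_eq_zero_of_natDegree_lt (by omega)⟩
  wlog hlt : i₁ < i₂ generalizing i₁ k₁ i₂ k₂
  · rw [facePoly_transpose, pathPairs_transpose]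
    exact this (by omega) hk₂ hk hi₁ hi hk₁ hi₂ (by omega) (by omega) (by omega)
  obtain ⟨i, rfl⟩ : ∃ i, i₂ = i + 2 := ⟨i₂ - 2, by omega⟩
  obtain ⟨k, rfl⟩ : ∃ k, k₂ = k + 1 := ⟨k₂ - 1, by omega⟩
  rcases i with _ | i
  · obtain rfl : i₁ = 1 := by omega
    obtain rfl : d = k₁ + (k + 1) := by omega
    rw [zero_add, facePoly_two_rows hk]
    have : pathPairs 1 k₁ 2 (k + 1) = 1 := by
      simp [pathPairs, show 1 + k₁ - 3 = k₁ - 2 by omega,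
        Nat.choose_eq_zero_of_lt (show k₁ - 2 < k₁ - 1 by omega)]
    rw [this]
    exact natDegree_le_and_coeff_one_add_X_pow _
  obtain ⟨d, rfl⟩ : ∃ e, d = e + 1 := ⟨d - 1, by omega⟩
  obtain ⟨hup, hup'⟩ := ih _ (by omega) rfl hi₁ (i₂ := i + 2) (by omega) hk₂ hk (by omega) hk₁
    (d := d) (by omega)
  rcases k with _ | k
  · rw [show i + 1 + 2 = i + 2 + 1 by omega, facePoly_succ_succ (by omega) hk,
      facePoly_zero k₁ (show i₁ ≤ i + 2 + 1 by omega) (show i₁ ≤ i + 2 by omega), add_sub_cancel_right,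
      coeff_one_add_X_mul hup, hup', ← pathPairs_succ_one]
    exact ⟨natDegree_one_add_X_mul_le hup, rfl⟩
  obtain ⟨hright, hright'⟩ := ih _ (by omega) rfl hi₁ (i₂ := i + 3) (k₂ := k + 1) (by omega)
    (by omega) (by omega) (by omega) hk₁ (d := d) (by omega)
  obtain ⟨d, rfl⟩ : ∃ e, d = e + 1 := ⟨d - 1, by omega⟩
  obtain ⟨hboth, -⟩ := ih _ (by omega) rfl hi₁ (i₂ := i + 2) (k₂ := k + 1) (by omega)
    (by omega) (by omega) (by omega) hk₁ (d := d) (by omega)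
  have hdeg : (facePoly i₁ k₁ (i + 2) (k + 1 + 1) + facePoly i₁ k₁ (i + 3) (k + 1) -
      facePoly i₁ k₁ (i + 2) (k + 1)).natDegree ≤ d + 1 :=
    (natDegree_sub_le_of_le (natDegree_add_le_of_degree_le hup hright)
      (hboth.trans d.le_succ)).trans (by simp)
  rw [show i + 1 + 2 = i + 2 + 1 by omega, facePoly_succ_succ (by omega) hk,
    coeff_one_add_X_mul hdeg, coeff_sub, coeff_add, hup', hright',
    coeff_eq_zero_of_natDegree_lt (Nat.lt_succ_of_le hboth), sub_zero]
  exact ⟨natDegree_one_add_X_mul_le hdeg, (pathPairs_succ_succ i₁ k₁ i k).symm⟩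

section Support

variable {α : Type*}

/-- Stars and bars with a prescribed support. -/
theorem card_sym_toFinset_eq [Fintype α] [DecidableEq α] {r : ℕ} {F : Finset α} (hF : F.card ≤ r) :
    (Finset.univ.filter fun f : Sym α r => (f : Multiset α).toFinset = F).card =
      F.card.multichoose (r - F.card) := by
  rw [← Fintype.card_coe F, ← Sym.card_sym_eq_multichoose, ← Finset.card_univ, Fintype.card_coe]
  symm
  refine Finset.card_bij
    (fun s _ => Sym.mk (F.val + (s : Multiset F).map Subtype.val) (by
      simp only [Multiset.card_add, Multiset.card_map, Sym.card_coe, Finset.card_val]; omega))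
    ?_ ?_ ?_
  · intro s _
    simp only [Finset.mem_filter, Finset.mem_univ, true_and, Sym.coe_mk]
    ext a
    simp +contextual
  · intro s _ t _ h
    have h' := congrArg (fun f : Sym α r => (f : Multiset α)) h
    simp only [Sym.coe_mk, add_right_inj] at h'
    exact Sym.coe_injective (Multiset.map_injective Subtype.val_injective h')
  · intro f hf
    simp only [Finset.mem_filter, Finset.mem_univ, true_and] at hf
    have hle : F.val ≤ (f : Multiset α) := by
      rw [← hf, Multiset.toFinset_val]
      exact Multiset.dedup_le _
    have hmem : ∀ a, a ∈ (f : Multiset α) - F.val → a ∈ F := fun a ha => by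
      rw [← hf, Multiset.mem_toFinset]
      exact Multiset.mem_of_le (Multiset.sub_le_self _ _) ha
    refine ⟨Sym.mk (((f : Multiset α) - F.val).pmap Subtype.mk hmem) ?_,
      Finset.mem_univ _, ?_⟩
    · simp [Multiset.card_sub hle]
    · apply Sym.coe_injective
      simp only [Sym.coe_mk, Multiset.map_pmap, Multiset.pmap_eq_map, Multiset.map_id']
      exact add_tsub_cancel_of_le hle

/-- The polynomial counting the monomials with a prescribed support of size `k`. -/
noncomputable def supportPoly (k : ℕ) : ℚ[X] :=
  if k = 0 then 0 else preHilbertPoly ℚ (k - 1) k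

theorem eval_supportPoly {k r : ℕ} (hr : 1 ≤ r) (hk : k ≤ r) :
    (supportPoly k).eval (r : ℚ) = k.multichoose (r - k) := by
  rcases k with _ | k
  · obtain ⟨r, rfl⟩ : ∃ s, r = s + 1 := ⟨r - 1, by omega⟩
    simp [supportPoly]
  · rw [supportPoly, if_neg k.succ_ne_zero, preHilbertPoly_eq_choose_sub_add _ _ hk,
      Nat.multichoose_eq, Nat.add_sub_cancel, show k + 1 + (r - (k + 1)) - 1 = r - (k + 1) + k by omega]
    exact congrArg _ (Nat.choose_symm_of_eq_add (add_comm _ _))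

theorem natCard_sym_eq_sum_eval [Fintype α] [DecidableEq α] (Q : Finset α → Prop) [DecidablePred Q] {r : ℕ}
    (hr : 1 ≤ r) (hα : Fintype.card α ≤ r) :
    (Nat.card {f : Sym α r // Q (f : Multiset α).toFinset} : ℚ) =
      ∑ F with Q F, (supportPoly F.card).eval (r : ℚ) := by
  rw [Nat.card_eq_fintype_card, Fintype.card_subtype,
    Finset.card_eq_sum_card_fiberwise (f := fun f : Sym α r => (f : Multiset α).toFinset)
      (t := Finset.univ.filter Q) (fun f hf => by simpa using hf), Nat.cast_sum]
  refine Finset.sum_congr rfl fun F hF => ?_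
  have hF' : F.card ≤ r := F.card_le_univ.trans hα
  rw [eval_supportPoly hr hF', ← card_sym_toFinset_eq hF', Finset.filter_filter]
  congr 2
  ext f
  simp only [Finset.mem_filter, Finset.mem_univ, true_and, and_iff_right_iff_imp] at hF ⊢
  rintro rfl
  exact hF

theorem coeff_sum_X_pow_card (S : Finset (Finset α)) (d : ℕ) :
    (∑ F ∈ S, (X : ℤ[X]) ^ F.card).coeff d = (S.filter fun F => F.card = d).card := by
  simp [coeff_X_pow, Finset.sum_boole, eq_comm]

theorem sum_supportPoly_leadingCoeff {S : Finset (Finset α)} {d : ℕ}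
    (hdeg : (∑ F ∈ S, (X : ℤ[X]) ^ F.card).natDegree ≤ d + 1)
    (hne : (∑ F ∈ S, (X : ℤ[X]) ^ F.card).coeff (d + 1) ≠ 0) :
    let p := ∑ F ∈ S, supportPoly F.card
    (p.natDegree.factorial : ℚ) * p.leadingCoeff =
      (∑ F ∈ S, (X : ℤ[X]) ^ F.card).coeff (d + 1) := by
  intro p
  have hcard : ∀ F ∈ S, F.card ≤ d + 1 := by
    intro F hF
    refine (le_natDegree_of_ne_zero ?_).trans hdeg
    rw [coeff_sum_X_pow_card]
    exact Nat.cast_ne_zero.2 (Finset.card_ne_zero_of_mem (Finset.mem_filter.2 ⟨hF, rfl⟩))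
  have hle : p.natDegree ≤ d := by
    refine natDegree_sum_le_of_forall_le _ _ fun F hF => ?_
    rw [supportPoly]
    split_ifs
    · simp
    · rw [natDegree_preHilbertPoly]
      have := hcard F hF
      omega
  have hcoeff : p.coeff d = (d.factorial : ℚ)⁻¹ *
      ((∑ F ∈ S, (X : ℤ[X]) ^ F.card).coeff (d + 1) : ℤ) := by
    rw [coeff_sum_X_pow_card, finsetSum_coeff, Finset.card_filter]
    push_cast
    rw [Finset.mul_sum]
    refine Finset.sum_congr rfl fun F hF => ?_
    have := hcard F hF
    split_ifs with h
    · simp [supportPoly, h, coeff_preHilbertPoly_self]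
    · rw [mul_zero, supportPoly]
      split_ifs
      · simp
      · refine coeff_eq_zero_of_natDegree_lt ?_
        rw [natDegree_preHilbertPoly]
        omega
  have hfac : (d.factorial : ℚ) ≠ 0 := by exact_mod_cast d.factorial_ne_zero
  have hp : p.natDegree = d := by
    refine natDegree_eq_of_le_of_coeff_ne_zero hle ?_
    rw [hcoeff]
    exact mul_ne_zero (inv_ne_zero hfac) (by exact_mod_cast hne)
  rw [leadingCoeff, hp, hcoeff, mul_inv_cancel_left₀ hfac]

end Support

section Counting

variable {m n ρ ξ r : ℕ}

/-- The position of a variable, measured from the top right corner of the grid. -/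
def cellEmbedding (m n : ℕ) : Fin m × Fin n ↪ ℕ × ℕ where
  toFun p := (p.1, n - 1 - p.2)
  inj' := by
    rintro ⟨a, b⟩ ⟨c, d⟩ h
    simp only [Prod.mk.injEq] at h
    ext <;> simp only <;> omega

@[simp]
theorem cellEmbedding_apply (m n : ℕ) (p : Fin m × Fin n) :
    cellEmbedding m n p = ((p.1 : ℕ), n - 1 - p.2) := rfl

theorem isFace_toFinset_map_iff (hξn : ξ ≤ n) (f : Sym (Fin m × Fin n) r) :
    IsFace ρ n m (n - ξ + 1) ((f : Multiset (Fin m × Fin n)).toFinset.map (cellEmbedding m n)) ↔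
      (∀ p ∈ idxMS m n r f, p.1 ≤ ρ ∨ ξ ≤ p.2) ∧
      ¬ Has3Chain (idxMS m n r f) ∧
      ¬ Has2Chain ((idxMS m n r f).filter (fun p => p.2 < ξ)) ∧
      ¬ Has2Chain ((idxMS m n r f).filter (fun p => ρ < p.1)) := by
  have hF : ∀ Q : ℕ × ℕ → Prop,
      (∀ a ∈ (f : Multiset (Fin m × Fin n)).toFinset.map (cellEmbedding m n), Q a) ↔
        ∀ a ∈ (f : Multiset (Fin m × Fin n)), Q (a.1, n - 1 - a.2) := by
    intro Q
    rw [Finset.forall_mem_map]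
    simp only [Multiset.mem_toFinset, cellEmbedding_apply]
  have hI : ∀ Q : ℕ × ℕ → Prop, (∀ a ∈ idxMS m n r f, Q a) ↔
      ∀ a ∈ (f : Multiset (Fin m × Fin n)), Q (a.1 + 1, a.2 + 1) := by
    intro Q
    simp only [idxMS, Multiset.mem_map, forall_exists_index, and_imp, forall_apply_eq_imp_iff₂]
  have hiff : ∀ i₁ k₁ i₂ k₂ F, IsFace i₁ k₁ i₂ k₂ F ↔ _ ∧ _ ∧ _ ∧ _ := fun i₁ k₁ i₂ k₂ F =>
    ⟨fun h => ⟨h.region, h.chain, h.columns, h.rows⟩, fun h => ⟨h.1, h.2.2.1, h.2.2.2, h.2.1⟩⟩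
  rw [hiff]
  simp only [Has2Chain, Has3Chain, not_exists, not_and, Multiset.mem_filter, and_imp, hF, hI]
  refine and_congr ?_ (and_congr ?_ (and_congr ?_ ?_))
  · refine forall₂_congr fun a _ => ?_
    have := a.2.2
    have := a.1.2
    omega
  · refine forall₂_congr fun a _ => forall₂_congr fun b _ => forall₂_congr fun c _ => ?_
    have := a.2.2
    have := b.2.2
    have := c.2.2
    omega
  · constructor
    · intro h a ha ha' b hb hb' hab
      have := h a ha b hb
      have := a.2.2
      have := b.2.2
      omega
    · intro h a ha b hb hab
      have := h a ha
      have := fun h' => this h' b hb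
      have := a.2.2
      have := b.2.2
      omega
  · constructor
    · intro h a ha ha' b hb hb' hab
      have := h a ha b hb
      have := a.2.2
      have := b.2.2
      omega
    · intro h a ha b hb hab
      have := h a ha
      have := fun h' => this h' b hb
      have := a.2.2
      have := b.2.2
      omega

theorem P2_eq_sum_eval (hξn : ξ ≤ n) (hr : 1 ≤ r) (hmn : m * n ≤ r) :
    (P2 m n ρ ξ r : ℚ) =
      (∑ F ∈ faces ρ n m (n - ξ + 1), supportPoly F.card).eval (r : ℚ) := by
  classical
  have hP : P2 m n ρ ξ r = Nat.card {f : Sym (Fin m × Fin n) r //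
      IsFace ρ n m (n - ξ + 1)
        ((f : Multiset (Fin m × Fin n)).toFinset.map (cellEmbedding m n))} :=
    Nat.card_congr (Equiv.subtypeEquivRight fun f => (isFace_toFinset_map_iff hξn f).symm)
  rw [hP, natCard_sym_eq_sum_eval
    (fun F => IsFace ρ n m (n - ξ + 1) (F.map (cellEmbedding m n))) hr (by simpa using hmn),
    eval_finsetSum]
  refine Finset.sum_bij (fun F _ => F.map (cellEmbedding m n)) ?_ ?_ ?_ ?_
  · intro F hF
    exact mem_faces.2 (Finset.mem_filter.1 hF).2
  · intro F _ G _ h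
    exact Finset.map_injective _ h
  · intro F hF
    have hF' := mem_faces.1 hF
    have hrange : ↑F ⊆ Set.range (cellEmbedding m n) := by
      intro a ha
      obtain ⟨h₁, h₂, -⟩ := hF'.region a ha
      refine ⟨(⟨a.1, h₁⟩, ⟨n - 1 - a.2, by omega⟩), ?_⟩
      ext
      · rfl
      · simp only [cellEmbedding_apply]
        omega
    obtain ⟨G, rfl⟩ : ∃ G : Finset (Fin m × Fin n), G.map (cellEmbedding m n) = F := by
      refine ⟨F.preimage _ (cellEmbedding m n).injective.injOn, ?_⟩
      rw [Finset.map_eq_image, Finset.image_preimage, Finset.filter_true_of_mem]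
      exact fun a ha => hrange ha
    exact ⟨G, Finset.mem_filter.2 ⟨Finset.mem_univ _, hF'⟩, rfl⟩
  · intro F _
    rw [Finset.card_map]

theorem factorial_mul_leadingCoeff_of_eventually_P2 (hξn : ξ ≤ n) {p : ℚ[X]}
    (hp : ∀ᶠ r in Filter.atTop, (P2 m n ρ ξ r : ℚ) = p.eval (r : ℚ)) {d : ℕ}
    (hdeg : (facePoly ρ n m (n - ξ + 1)).natDegree ≤ d + 1)
    (hne : (facePoly ρ n m (n - ξ + 1)).coeff (d + 1) ≠ 0) :
    (p.natDegree.factorial : ℚ) * p.leadingCoeff = (facePoly ρ n m (n - ξ + 1)).coeff (d + 1) := by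
  have hpq : p = ∑ F ∈ faces ρ n m (n - ξ + 1), supportPoly F.card := by
    obtain ⟨N, hN⟩ := Filter.eventually_atTop.1 hp
    refine eq_of_infinite_eval_eq _ _ (Set.infinite_of_injective_forall_mem
      (f := fun r : ℕ => ((r + N + m * n + 1 : ℕ) : ℚ)) (fun a b h => ?_) fun r => ?_)
    · have := Nat.cast_injective h
      omega
    · rw [Set.mem_ofPred_eq, ← hN _ (by omega), P2_eq_sum_eval hξn (by omega) (by omega)]
  rw [hpq]
  exact sum_supportPoly_leadingCoeff hdeg hne

end Counting

theorem pathPairs_eq (a b i k : ℕ) :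
    ((pathPairs (a + 1) (b + 2) (i + 2) (k + 1) : ℤ) : ℚ) =
      (((i + 1 : ℚ) * (b + 1) - a * k) / ((i + 1) * (b + 1))) *
        (i + k).choose i * (a + b).choose b := by
  have h₁ : ((i + k).choose (i + 1) : ℚ) * (i + 1) = (i + k).choose i * k := by
    have := Nat.choose_succ_right_eq (i + k) i
    rw [Nat.add_sub_cancel_left] at this
    exact_mod_cast this
  have h₂ : ((a + b).choose (b + 1) : ℚ) * (b + 1) = (a + b).choose b * a := by
    have := Nat.choose_succ_right_eq (a + b) b
    rw [Nat.add_sub_cancel] at this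
    exact_mod_cast this
  simp only [pathPairs, show a + 1 + (b + 2) - 3 = a + b by omega,
    show i + 2 + (k + 1) - 3 = i + k by omega, show b + 2 - 2 = b by omega,
    show b + 2 - 1 = b + 1 by omega, show i + 2 - 2 = i by omega, show i + 2 - 1 = i + 1 by omega]
  push_cast
  have hi : (i + 1 : ℚ) ≠ 0 := by positivity
  have hb : (b + 1 : ℚ) ≠ 0 := by positivity
  field_simp
  linear_combination (-((a + b).choose (b + 1) : ℚ) * (b + 1)) * h₁ -
    ((i + k).choose i * k : ℚ) * h₂

theorem P2_eq_of_diagonal {m n r : ℕ} (hn : 1 ≤ n) :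
    P2 (m + 1) n (m + 1) 1 r = P2 (m + 1) n m 1 r := by
  refine Nat.card_congr (Equiv.subtypeEquivRight fun f => ?_)
  rw [← isFace_toFinset_map_iff hn, ← isFace_toFinset_map_iff hn,
    ← mem_faces, ← mem_faces, Nat.sub_add_cancel hn, faces_diagonal]

theorem leadingCoeff_of_ne_corner {m n ρ ξ : ℕ} (hm : 2 ≤ m) (hn : 2 ≤ n) (hρ1 : 1 ≤ ρ)
    (hρm : ρ ≤ m) (hξ1 : 1 ≤ ξ) (hξn : ξ ≤ n) (hne : ¬ (ρ = m ∧ ξ = 1)) {p : ℚ[X]}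
    (hp : ∀ᶠ r in Filter.atTop, (P2 m n ρ ξ r : ℚ) = p.eval (r : ℚ)) :
    (p.natDegree.factorial : ℚ) * p.leadingCoeff =
      ((((m : ℚ) - ρ) * (n - 1) + (ρ - 1) * (ξ - 1)) / ((m - 1) * (n - 1))) *
        (m + n - ξ - 2).choose (m - 2) * (ρ + n - 3).choose (n - 2) := by
  obtain ⟨i, rfl⟩ := Nat.exists_eq_add_of_le' hm
  obtain ⟨b, rfl⟩ := Nat.exists_eq_add_of_le' hn
  obtain ⟨a, rfl⟩ := Nat.exists_eq_add_of_le' hρ1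
  obtain ⟨k, hk⟩ := Nat.exists_eq_add_of_le hξn
  have hk' : b + 2 - ξ = k := by omega
  have hkQ : (b : ℚ) + 2 = ξ + k := by exact_mod_cast hk
  obtain ⟨hdeg, hcoeff⟩ := facePoly_natDegree_le_and_coeff (i₁ := a + 1) (k₁ := b + 2)
    (i₂ := i + 2) (k₂ := b + 2 - ξ + 1) (d := a + b + i + k + 2 + 1) rfl (by omega) hρm (by omega)
    (by omega) hm hn (by omega)
  have hval := pathPairs_eq a b i k
  rw [← hk', ← hcoeff, hk'] at hval
  have hnum : ((i + 1 : ℚ) * (b + 1) - a * k) =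
      ((i + 2 : ℕ) - (a + 1 : ℕ) : ℚ) * ((b + 2 : ℕ) - 1) + ((a + 1 : ℕ) - 1) * (ξ - 1) := by
    push_cast
    linear_combination (a : ℚ) * hkQ
  have hpos : (0 : ℚ) < (i + 1 : ℚ) * (b + 1) - a * k := by
    rw [sub_pos]
    have h : a * k < (i + 1) * (b + 1) := by
      by_cases ha : a = i + 1
      · exact ha ▸ Nat.mul_lt_mul_of_pos_left (by omega) (by omega)
      · exact Nat.mul_lt_mul_of_lt_of_le (by omega) (by omega) (by omega)
    exact_mod_cast h
  have hne0 : (facePoly (a + 1) (b + 2) (i + 2) (b + 2 - ξ + 1)).coeff (a + b + i + k + 2 + 1) ≠ 0 := by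
    rw [← Int.cast_ne_zero (α := ℚ), hk', hval]
    have h₁ : 0 < (i + k).choose i := Nat.choose_pos (by omega)
    have h₂ : 0 < (a + b).choose b := Nat.choose_pos (by omega)
    positivity
  rw [factorial_mul_leadingCoeff_of_eventually_P2 hξn hp hdeg hne0, hk', hval, hnum,
    show i + 2 + (b + 2) - ξ - 2 = i + k by omega, show a + 1 + (b + 2) - 3 = a + b by omega,
    Nat.add_sub_cancel, Nat.add_sub_cancel]
  congr 4 <;> push_cast <;> ring

theorem leadingCoeff_of_one_row_or_column {m n ρ ξ : ℕ} (hmn : m = 1 ∨ n = 1) (hρ1 : 1 ≤ ρ)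
    (hρm : ρ ≤ m) (hξ1 : 1 ≤ ξ) (hξn : ξ ≤ n) {p : ℚ[X]}
    (hp : ∀ᶠ r in Filter.atTop, (P2 m n ρ ξ r : ℚ) = p.eval (r : ℚ)) :
    (p.natDegree.factorial : ℚ) * p.leadingCoeff = 1 := by
  have h : ∃ d, facePoly ρ n m (n - ξ + 1) = (1 + X) ^ (d + 1) := by
    rcases hmn with rfl | rfl
    · obtain rfl : ρ = 1 := by omega
      exact ⟨n - 1, by rw [facePoly_one_row, Nat.sub_add_cancel (by omega)]⟩
    · obtain rfl : ξ = 1 := by omega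
      exact ⟨m - 1, by rw [facePoly_transpose, facePoly_one_row, Nat.sub_add_cancel (by omega)]⟩
  obtain ⟨d, hd⟩ := h
  obtain ⟨hdeg, hcoeff⟩ := natDegree_le_and_coeff_one_add_X_pow (d + 1)
  rw [← hd] at hdeg hcoeff
  rw [factorial_mul_leadingCoeff_of_eventually_P2 hξn hp hdeg (by simp [hcoeff]), hcoeff,
    Int.cast_one]

end Proof

/-- Proposition 2.3 (second part) of the paper: the leading coefficient of the eventual
polynomial of `P2`, normalized by the factorial of its degree. -/
theorem P2_leadingCoeff (m n ρ ξ : ℕ) (hm : 1 ≤ m) (hn : 1 ≤ n)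
    (hρ1 : 1 ≤ ρ) (hρm : ρ ≤ m) (hξ1 : 1 ≤ ξ) (hξn : ξ ≤ n)
    (p : Polynomial ℚ)
    (hp : ∀ᶠ r in Filter.atTop, (P2 m n ρ ξ r : ℚ) = p.eval (r : ℚ)) :
    (Nat.factorial p.natDegree : ℚ) * p.leadingCoeff =
      if m = 1 ∨ n = 1 then 1
      else if ρ = m ∧ ξ = 1 then
        (1 / ((n : ℚ) - 1)) *
          (Nat.choose (m + n - 4) (m - 2) : ℚ) * (Nat.choose (m + n - 3) (n - 2) : ℚ)
      else
        ((((m : ℚ) - (ρ : ℚ)) * ((n : ℚ) - 1) + ((ρ : ℚ) - 1) * ((ξ : ℚ) - 1)) /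
            (((m : ℚ) - 1) * ((n : ℚ) - 1))) *
          (Nat.choose (m + n - ξ - 2) (m - 2) : ℚ) * (Nat.choose (ρ + n - 3) (n - 2) : ℚ) := by
  split_ifs with h₁ h₂
  · exact leadingCoeff_of_one_row_or_column h₁ hρ1 hρm hξ1 hξn hp
  · obtain ⟨rfl, rfl⟩ := h₂
    obtain ⟨i, rfl⟩ : ∃ i, ρ = i + 1 + 1 := ⟨ρ - 2, by omega⟩
    obtain ⟨b, rfl⟩ : ∃ b, n = b + 2 := ⟨n - 2, by omega⟩
    simp only [P2_eq_of_diagonal hn] at hp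
    rw [leadingCoeff_of_ne_corner (by omega) (by omega) (by omega) (by omega) le_rfl hn (by omega)
      hp]
    have h : ((i + b + 1).choose i : ℚ) * (b + 1) = (i + b + 1).choose b * (i + 1) := by
      have h₁ := Nat.choose_mul_succ_eq (i + b) i
      have h₂ := Nat.choose_mul_succ_eq (i + b) b
      rw [show i + b + 1 - i = b + 1 by omega] at h₁
      rw [show i + b + 1 - b = i + 1 by omega, ← Nat.choose_symm_add] at h₂
      exact_mod_cast h₁.symm.trans h₂
    rw [show i + 1 + 1 + (b + 2) - 1 - 2 = i + b + 1 by omega,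
      show i + 1 + (b + 2) - 3 = i + b by omega,
      show i + 1 + 1 + (b + 2) - 4 = i + b by omega,
      show i + 1 + 1 + (b + 2) - 3 = i + b + 1 by omega,
      show i + 1 + 1 - 2 = i by omega, show b + 2 - 2 = b by omega, ← Nat.choose_symm_add]
    push_cast
    have hi : (i : ℚ) + 1 + 1 - 1 ≠ 0 := by ring_nf; positivity
    have hb : (b : ℚ) + 2 - 1 ≠ 0 := by ring_nf; positivity
    field_simp
    linear_combination ((i + b).choose i : ℚ) * h
  · exact leadingCoeff_of_ne_corner (by omega) (by omega) hρ1 hρm hξ1 hξn h₂ hp
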